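/- Let (A,b,c) be an s-stage Runge–Kutta method with Σ_j a_{ij} = c_i for every i, and let p ≥ 1. Then bΦ(t) = 1/t! holds for every rooted tree t with |t| ≤ p if and only if both: (i) Σ_j b_j c_j^n = 1/(n+1) for every 0 ≤ n < p, and (ii) for every k ≥ 1, all rooted trees t₁,…,t_k, and every integer n ≥ 0 with |t₁| + … + |t_k| + n < p, one has Σ_i b_i Q_i(t₁) Q_i(t₂) ⋯ Q_i(t_k) c_i^n = 0. -/

import Mathlib

/-- Rooted trees: `node ts` is the tree obtained by connecting the roots of the
trees in `ts` by new edges to a new root vertex; `node []` is the one-vertex tree `•`. -/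
inductive RTree where
  | node : List RTree → RTree

namespace RTree

/-- The order `|t|` of a rooted tree: its number of vertices. -/
def order : RTree → ℕ
  | node ts => 1 + (ts.attach.map fun x => order x.1).sum
decreasing_by
  simp only [RTree.node.sizeOf_spec]; have := List.sizeOf_lt_of_mem x.2; omega

/-- The tree factorial: `•! = 1` and `[t₁…tₙ]! = |[t₁…tₙ]| ⬝ ∏ₘ tₘ!`. -/
def factorial : RTree → ℕ
  | node ts => (node ts).order * (ts.attach.map fun x => factorial x.1).prod
decreasing_by
  simp only [RTree.node.sizeOf_spec]; have := List.sizeOf_lt_of_mem x.2; omega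

end RTree

/-- Derivative weights: `Φ(•) = 𝟙` and `Φ([t₁…tₙ]) = ∏ₘ (A·Φ(tₘ))`, element-wise. -/
def Phi {s : ℕ} (A : Matrix (Fin s) (Fin s) ℝ) : RTree → Fin s → ℝ
  | .node ts => fun i => (ts.attach.map fun x => A.mulVec (Phi A x.1) i).prod
decreasing_by
  simp only [RTree.node.sizeOf_spec]; have := List.sizeOf_lt_of_mem x.2; omega

/-- `Q(t) = A·Φ(t) − c^{|t|}/t!`. -/
noncomputable def Qvec {s : ℕ} (A : Matrix (Fin s) (Fin s) ℝ) (c : Fin s → ℝ) (t : RTree)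
    (i : Fin s) : ℝ :=
  A.mulVec (Phi A t) i - c i ^ t.order / (t.factorial : ℝ)

namespace RTree

theorem order_node (ts : List RTree) : (node ts).order = 1 + (ts.map order).sum := by
  rw [order, List.attach_map_val (f := order)]

theorem factorial_node (ts : List RTree) :
    (node ts).factorial = (node ts).order * (ts.map factorial).prod := by
  rw [factorial, List.attach_map_val (f := factorial)]

end RTree

theorem Phi_node {s : ℕ} (A : Matrix (Fin s) (Fin s) ℝ) (ts : List RTree) (i : Fin s) :
    Phi A (.node ts) i = (ts.map fun t => A.mulVec (Phi A t) i).prod := by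
  rw [Phi]
  exact congrArg List.prod (List.attach_map_val (f := fun t => A.mulVec (Phi A t) i))

theorem mulVec_Phi_leaf {s : ℕ} (A : Matrix (Fin s) (Fin s) ℝ) (c : Fin s → ℝ)
    (hA : ∀ i, ∑ j, A i j = c i) (i : Fin s) : A.mulVec (Phi A (.node [])) i = c i := by
  simp [Matrix.mulVec, dotProduct, Phi_node, hA]

/-- The mixed sum `∑ᵢ bᵢ ∏ᵤ (A·Φ(u))ᵢ ∏ₜ Qᵢ(t) cᵢⁿ`, over `u ∈ us` and `t ∈ ts`. -/
noncomputable def mixedSum {s : ℕ} (A : Matrix (Fin s) (Fin s) ℝ) (b c : Fin s → ℝ)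
    (us ts : List RTree) (n : ℕ) : ℝ :=
  ∑ i, b i * (us.map fun u => A.mulVec (Phi A u) i).prod *
    (ts.map fun t => Qvec A c t i).prod * c i ^ n

/-- The value that the order conditions force on `mixedSum A b c us ts n`. -/
noncomputable def mixedValue (us ts : List RTree) (n : ℕ) : ℝ :=
  match ts with
  | [] => 1 / ((((us.map RTree.order).sum + n : ℕ) + 1 : ℝ) * (us.map RTree.factorial).prod)
  | _ :: _ => 0

/-- Expanding `A·Φ(t) = Q(t) + c^{|t|}/t!` in one factor of a mixed sum. -/
theorem mixedSum_cons {s : ℕ} (A : Matrix (Fin s) (Fin s) ℝ) (b c : Fin s → ℝ)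
    (us ts : List RTree) (t : RTree) (n : ℕ) :
    mixedSum A b c (t :: us) ts n = mixedSum A b c us (t :: ts) n +
      mixedSum A b c us ts (t.order + n) / (t.factorial : ℝ) := by
  simp only [mixedSum, Finset.sum_div, ← Finset.sum_add_distrib]
  refine Finset.sum_congr rfl fun i _ => ?_
  simp only [List.map_cons, List.prod_cons, Qvec, pow_add]
  ring

theorem mixedValue_cons (us ts : List RTree) (t : RTree) (n : ℕ) :
    mixedValue (t :: us) ts n = mixedValue us (t :: ts) n +
      mixedValue us ts (t.order + n) / (t.factorial : ℝ) := by
  cases ts with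
  | nil =>
    simp only [mixedValue, List.map_cons, List.sum_cons, List.prod_cons, zero_add, div_div]
    push_cast
    congr 1
    ring
  | cons => simp [mixedValue]

theorem mixedSum_nil_right {s : ℕ} (A : Matrix (Fin s) (Fin s) ℝ) (b c : Fin s → ℝ)
    (hA : ∀ i, ∑ j, A i j = c i) (us : List RTree) (n : ℕ) :
    mixedSum A b c us [] n =
      ∑ i, b i * Phi A (.node (us ++ List.replicate n (.node []))) i := by
  simp [mixedSum, Phi_node, mulVec_Phi_leaf A c hA, mul_assoc]

theorem mixedValue_nil_right (us : List RTree) (n : ℕ) :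
    mixedValue us [] n =
      1 / ((RTree.node (us ++ List.replicate n (.node []))).factorial : ℝ) := by
  have leaf_order : (RTree.node []).order = 1 := by simp [RTree.order_node]
  have leaf_factorial : (RTree.node []).factorial = 1 := by
    simp [RTree.factorial_node, leaf_order]
  rw [RTree.factorial_node, RTree.order_node]
  simp only [mixedValue, List.map_append, List.map_replicate, leaf_order, leaf_factorial,
    List.sum_append, List.prod_append, List.sum_replicate, List.prod_replicate, smul_eq_mul]
  push_cast
  congr 1
  ring

theorem order_append_replicate_leaf (us : List RTree) (n : ℕ) :
    (RTree.node (us ++ List.replicate n (.node []))).order =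
      (us.map RTree.order).sum + n + 1 := by
  have leaf_order : (RTree.node []).order = 1 := by simp [RTree.order_node]
  simp [RTree.order_node, leaf_order]
  ring

/-- Order conditions up to order `p` determine all mixed sums of total order below `p`. -/
theorem mixedSum_eq_of_order_conditions {s : ℕ} (A : Matrix (Fin s) (Fin s) ℝ)
    (b c : Fin s → ℝ) (hA : ∀ i, ∑ j, A i j = c i) (p : ℕ)
    (h : ∀ t : RTree, t.order ≤ p → ∑ i, b i * Phi A t i = 1 / (t.factorial : ℝ))
    (ts us : List RTree) (n : ℕ)
    (hlt : (us.map RTree.order).sum + (ts.map RTree.order).sum + n < p) :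
    mixedSum A b c us ts n = mixedValue us ts n := by
  induction ts generalizing us n with
  | nil =>
    rw [mixedSum_nil_right A b c hA, mixedValue_nil_right]
    refine h _ ?_
    rw [order_append_replicate_leaf]
    simp only [List.map_nil, List.sum_nil] at hlt
    omega
  | cons t ts ih =>
    simp only [List.map_cons, List.sum_cons] at hlt
    have expand := mixedSum_cons A b c us ts t n
    rw [ih (t :: us) n (by simp only [List.map_cons, List.sum_cons]; omega),
      ih us (t.order + n) (by omega), mixedValue_cons] at expand
    linarith

/-- Quadrature and Q-type conditions determine all mixed sums of total order below `p`. -/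
theorem mixedSum_eq_of_Q_type {s : ℕ} (A : Matrix (Fin s) (Fin s) ℝ)
    (b c : Fin s → ℝ) (p : ℕ)
    (hquad : ∀ n < p, ∑ j, b j * c j ^ n = 1 / ((n : ℝ) + 1))
    (hQ : ∀ (ts : List RTree) (n : ℕ), ts ≠ [] → (ts.map RTree.order).sum + n < p →
      (∑ i, b i * (ts.map fun t => Qvec A c t i).prod * c i ^ n) = 0)
    (us ts : List RTree) (n : ℕ)
    (hlt : (us.map RTree.order).sum + (ts.map RTree.order).sum + n < p) :
    mixedSum A b c us ts n = mixedValue us ts n := by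
  induction us generalizing ts n with
  | nil =>
    cases ts with
    | nil => simpa [mixedSum, mixedValue] using hquad n (by simpa using hlt)
    | cons t ts =>
      simpa [mixedSum, mixedValue] using hQ (t :: ts) n (by simp) (by simpa using hlt)
  | cons u us ih =>
    simp only [List.map_cons, List.sum_cons] at hlt
    rw [mixedSum_cons, mixedValue_cons,
      ih (u :: ts) n (by simp only [List.map_cons, List.sum_cons]; omega),
      ih ts (u.order + n) (by omega)]


/-- Order conditions up to order `p` hold iff the quadrature conditions and the
Q-type order conditions hold. -/
theorem order_conditions_iff_Q_type {s : ℕ} (A : Matrix (Fin s) (Fin s) ℝ)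
    (b c : Fin s → ℝ) (hA : ∀ i, ∑ j, A i j = c i) (p : ℕ) (hp : 1 ≤ p) :
    (∀ t : RTree, t.order ≤ p → ∑ i, b i * Phi A t i = 1 / (t.factorial : ℝ)) ↔
      ((∀ n < p, ∑ j, b j * c j ^ n = 1 / ((n : ℝ) + 1)) ∧
        (∀ (ts : List RTree) (n : ℕ), ts ≠ [] →
          (ts.map RTree.order).sum + n < p →
          (∑ i, b i * (ts.map fun t => Qvec A c t i).prod * c i ^ n) = 0)) := by
  constructor
  · intro h
    have key := mixedSum_eq_of_order_conditions A b c hA p h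
    refine ⟨fun n hn => ?_, fun ts n hts hlt => ?_⟩
    · simpa [mixedSum, mixedValue] using key [] [] n (by simpa using hn)
    · cases ts with
      | nil => exact absurd rfl hts
      | cons t ts => simpa [mixedSum, mixedValue] using key (t :: ts) [] n (by simpa using hlt)
  · rintro ⟨hquad, hQ⟩ ⟨us⟩ hle
    have key := mixedSum_eq_of_Q_type A b c p hquad hQ us [] 0 (by
      rw [RTree.order_node] at hle
      simp only [List.map_nil, List.sum_nil]
      omega)
    rw [mixedSum_nil_right A b c hA, mixedValue_nil_right] at key
    simpa using key
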